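/- Let n be a nonnegative integer and a, b, c, p, q, w ∈ ℂ. Assume a − q ≠ 0, 1+2q−w+n ≠ 0 and bc − p(a−p) ≠ 0, and set α = q(1+a−w)/(a−q), β = (q(1+a−w)+n(a−q))/(1+2q−w+n), γ = p(a−p)(b+c−a)/(bc − p(a−p)). Assume the parameters are nondegenerate for the identity below. Then ₇F₆(a, b, c, a−p+1, p+1, q+1, −n; 1+a−b, 1+a−c, p, a−p, q, w; 1) = ((w−a−1)_n (α+1)_n / ((w)_n (α)_n)) · ₇F₆(1+a−w, a/2, (a+1)/2, a−b−c, β+1, γ+1, −n; 1+a−b, 1+a−c, (2+a−w−n)/2, (3+a−w−n)/2, β, γ; 1). -/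

import Mathlib

/-- Rising factorial (Pochhammer symbol) `(a)ₖ = a(a+1)⋯(a+k−1)`. -/
noncomputable def poch (a : ℂ) (k : ℕ) : ℂ := (ascPochhammer ℂ k).eval a

/-- Terminating hypergeometric sum with numerator parameters `A` together with
the extra top parameter `-n`, denominator parameters `B`, and argument `x`. -/
noncomputable def hypTerm (A B : List ℂ) (n : ℕ) (x : ℂ) : ℂ :=
  ∑ k ∈ Finset.range (n + 1),
    ((A.map fun a => poch a k).prod * poch (-(n : ℂ)) k) /
      ((k.factorial : ℂ) * (B.map fun b => poch b k).prod) * x ^ k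

section PochhammerSums

open Finset

theorem poch_zero (a : ℂ) : poch a 0 = 1 := by simp [poch]

theorem poch_succ (a : ℂ) (k : ℕ) : poch a (k + 1) = poch a k * (a + k) := by
  simp [poch, ascPochhammer_succ_eval]

theorem poch_add (a : ℂ) (m k : ℕ) : poch a (m + k) = poch a m * poch (a + m) k := by
  induction k with
  | zero => simp [poch_zero]
  | succ k ih => rw [← add_assoc, poch_succ, poch_succ, ih]; push_cast; ring

theorem poch_succ' (a : ℂ) (k : ℕ) : poch a (k + 1) = a * poch (a + 1) k := by
  rw [add_comm, poch_add, poch_succ, poch_zero]; simp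

theorem mul_poch_add_one (a : ℂ) (k : ℕ) : a * poch (a + 1) k = poch a k * (a + k) := by
  rw [← poch_succ', poch_succ]

theorem poch_reflect (a : ℂ) (k : ℕ) : poch (1 - a - k) k = (-1) ^ k * poch a k := by
  induction k with
  | zero => simp [poch_zero]
  | succ k ih =>
    rw [poch_succ', poch_succ, pow_succ,
      show 1 - a - ((k + 1 : ℕ) : ℂ) + 1 = 1 - a - k by push_cast; ring, ih]
    push_cast; ring

theorem poch_neg_natCast (N m : ℕ) :
    poch (-(N : ℂ)) m = (-1) ^ m * (N.choose m : ℂ) * (m.factorial : ℂ) := by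
  have h : (N.descFactorial m : ℂ) = (m.factorial : ℂ) * (N.choose m : ℂ) := by
    exact_mod_cast Nat.descFactorial_eq_factorial_mul_choose N m
  rw [mul_assoc, mul_comm (N.choose m : ℂ), ← h]
  clear h
  induction m with
  | zero => simp [poch_zero]
  | succ m ih =>
    rw [poch_succ, ih, Nat.descFactorial_succ]
    rcases le_or_gt m N with hm | hm
    · push_cast [Nat.cast_sub hm]; ring
    · simp [Nat.descFactorial_of_lt hm]

theorem poch_neg_add_mul_factorial (j m : ℕ) :
    poch (-((j + m : ℕ) : ℂ)) j * (m.factorial : ℂ) = (-1) ^ j * ((j + m).factorial : ℂ) := by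
  have h := Nat.add_choose_mul_factorial_mul_factorial j m
  rw [poch_neg_natCast, ← h, Nat.choose_symm_add]; push_cast; ring

theorem poch_neg_natCast_succ_self (k : ℕ) : poch (-(k : ℂ)) (k + 1) = 0 := by
  simp [poch_succ]

theorem poch_half_mul (a : ℂ) (j : ℕ) :
    4 ^ j * (poch (a / 2) j * poch ((a + 1) / 2) j) = poch a (2 * j) := by
  induction j with
  | zero => simp [poch_zero]
  | succ j ih =>
    rw [show 2 * (j + 1) = 2 * j + 1 + 1 by ring, poch_succ a, poch_succ a, ← ih]
    simp only [poch_succ]; push_cast; ring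

/-- Chu–Vandermonde with an additional linear weight. -/
theorem chu_vandermonde_weighted (N : ℕ) (A Q W : ℂ) :
    (W - A - 1) * ∑ m ∈ range (N + 1), (N.choose m : ℂ) *
        ((-1) ^ m * poch A m * poch (W + m) (N - m) * (Q + m)) =
      poch (W - A - 1) N * ((W - A + N - 1) * Q - A * N) := by
  induction N generalizing A Q W with
  | zero => simp [poch_zero]
  | succ N ih =>
    rw [Finset.sum_choose_succ_mul
      (fun m r => (-1) ^ m * poch A m * poch (W + m) r * (Q + m)) N]
    have h1 : ∑ m ∈ range (N + 1), (N.choose m : ℂ) *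
          ((-1) ^ m * poch A m * poch (W + m) (N + 1 - m) * (Q + m)) =
        (W + N) * ∑ m ∈ range (N + 1), (N.choose m : ℂ) *
          ((-1) ^ m * poch A m * poch (W + m) (N - m) * (Q + m)) := by
      rw [mul_sum]
      refine sum_congr rfl fun m hm => ?_
      have hm : m ≤ N := Nat.lt_succ_iff.mp (mem_range.mp hm)
      rw [Nat.succ_sub hm, poch_succ, Nat.cast_sub hm]; ring
    have h2 : ∑ m ∈ range (N + 1), (N.choose m : ℂ) *
          ((-1) ^ (m + 1) * poch A (m + 1) * poch (W + (m + 1 : ℕ)) (N - m) *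
            (Q + (m + 1 : ℕ))) =
        -A * ∑ m ∈ range (N + 1), (N.choose m : ℂ) *
          ((-1) ^ m * poch (A + 1) m * poch (W + 1 + m) (N - m) * (Q + 1 + m)) := by
      rw [mul_sum]
      refine sum_congr rfl fun m _ => ?_
      rw [poch_succ', show W + ((m + 1 : ℕ) : ℂ) = W + 1 + m by push_cast; ring]
      push_cast; ring
    have e1 := ih A Q W
    have e2 := ih (A + 1) (Q + 1) (W + 1)
    rw [show W + 1 - (A + 1) - 1 = W - A - 1 by ring] at e2
    rw [h1, h2, poch_succ]
    push_cast
    linear_combination (W + N) * e1 - A * e2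

/-- Partial sums of the telescoping relation behind the Pfaff–Saalschütz theorem. -/
theorem saalschuetz_telescope (a e f : ℂ) (k M : ℕ)
    (he : ∀ j ≤ M, poch e j ≠ 0) (hf : ∀ j ≤ M, poch f j ≠ 0) :
    (e + k) * (f + k) * ∑ j ∈ range (M + 1),
        poch (-((k + 1 : ℕ) : ℂ)) j * poch (a + (k + 1 : ℕ)) j * poch (e + f - 1 - a) j /
          (j.factorial * (poch e j * poch f j)) -
      (1 + a - e + k) * (1 + a - f + k) * ∑ j ∈ range (M + 1),
        poch (-(k : ℂ)) j * poch (a + k) j * poch (e + f - 1 - a) j /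
          (j.factorial * (poch e j * poch f j)) =
      (1 + a + 2 * k) * (poch (-(k : ℂ)) M * poch (a + k + 1) M * poch (e + f - 1 - a) (M + 1)) /
        (M.factorial * (poch e M * poch f M)) := by
  induction M with
  | zero => simp [poch_zero, poch_succ]; ring
  | succ M ih =>
    rw [sum_range_succ _ (M + 1), sum_range_succ _ (M + 1)]
    have ih := ih (fun j hj => he j (by omega)) (fun j hj => hf j (by omega))
    rw [mul_add ((e + k) * (f + k)), mul_add ((1 + a - e + k) * (1 + a - f + k)),
      add_sub_add_comm, ih]
    have e1 := he (M + 1) le_rfl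
    have f1 := hf (M + 1) le_rfl
    rw [poch_succ] at e1 f1
    have e2 := left_ne_zero_of_mul e1
    have e3 := right_ne_zero_of_mul e1
    have f2 := left_ne_zero_of_mul f1
    have f3 := right_ne_zero_of_mul f1
    have hM : ((M : ℂ) + 1) ≠ 0 := by exact_mod_cast Nat.succ_ne_zero M
    have hF : (M.factorial : ℂ) ≠ 0 := by exact_mod_cast M.factorial_ne_zero
    rw [poch_succ' (-((k + 1 : ℕ) : ℂ)), poch_succ' (a + k), poch_succ (a + (k + 1 : ℕ)),
      poch_succ (e + f - 1 - a) (M + 1), poch_succ (e + f - 1 - a) M,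
      poch_succ (-(k : ℂ)), poch_succ (a + k + 1), poch_succ e, poch_succ f, Nat.factorial_succ,
      show -((k + 1 : ℕ) : ℂ) + 1 = -(k : ℂ) by push_cast; ring,
      show a + ((k + 1 : ℕ) : ℂ) = a + k + 1 by push_cast; ring]
    push_cast
    field_simp
    ring

/-- The Pfaff–Saalschütz theorem. -/
theorem saalschuetz (a e f : ℂ) (k : ℕ)
    (he : ∀ j ≤ k, poch e j ≠ 0) (hf : ∀ j ≤ k, poch f j ≠ 0) :
    ∑ j ∈ range (k + 1), poch (-(k : ℂ)) j * poch (a + k) j * poch (e + f - 1 - a) j /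
        (j.factorial * (poch e j * poch f j)) =
      poch (1 + a - e) k * poch (1 + a - f) k / (poch e k * poch f k) := by
  induction k with
  | zero => simp [poch_zero]
  | succ k ih =>
    have ih := ih (fun j hj => he j (by omega)) (fun j hj => hf j (by omega))
    have h := saalschuetz_telescope a e f k (k + 1) he hf
    rw [sum_range_succ (fun j => poch (-(k : ℂ)) j * poch (a + k) j * poch (e + f - 1 - a) j /
      (j.factorial * (poch e j * poch f j))) (k + 1), ih, poch_neg_natCast_succ_self] at h
    have e1 := he (k + 1) le_rfl
    have f1 := hf (k + 1) le_rfl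
    rw [poch_succ] at e1 f1
    have e2 := left_ne_zero_of_mul e1
    have e3 := right_ne_zero_of_mul e1
    have f2 := left_ne_zero_of_mul f1
    have f3 := right_ne_zero_of_mul f1
    apply mul_left_cancel₀ (mul_ne_zero e3 f3)
    simp only [zero_mul, mul_zero, zero_div, add_zero] at h
    rw [sub_eq_zero.mp h]
    simp only [poch_succ _ k]
    field_simp

/-- The Pfaff–Saalschütz theorem with an additional linear weight. -/
theorem saalschuetz_weighted (a b c P : ℂ) (k : ℕ) (hs : a - b - c ≠ 0)
    (he : ∀ j ≤ k, poch (1 + a - b) j ≠ 0) (hf : ∀ j ≤ k, poch (1 + a - c) j ≠ 0) :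
    ∑ j ∈ range (k + 1), poch (-(k : ℂ)) j * poch (a + k) j *
        (poch (a - b - c) j * (P * (a - b - c + j) - j * (b * c)) /
          (j.factorial * (poch (1 + a - b) j * poch (1 + a - c) j))) =
      (a - b - c) * (P + k * (a + k)) * (poch b k * poch c k) /
        (poch (1 + a - b) k * poch (1 + a - c) k) := by
  have h := saalschuetz a (1 + a - b) (1 + a - c) k he hf
  rw [show 1 + a - b + (1 + a - c) - 1 - a = a - b - c + 1 by ring,
    show 1 + a - (1 + a - b) = b by ring, show 1 + a - (1 + a - c) = c by ring] at h
  have split : ∀ j, poch (-(k : ℂ)) j * poch (a + k) j *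
        (poch (a - b - c) j * (P * (a - b - c + j) - j * (b * c)) /
          (j.factorial * (poch (1 + a - b) j * poch (1 + a - c) j))) =
      (a - b - c) * P * (poch (-(k : ℂ)) j * poch (a + k) j * poch (a - b - c + 1) j /
          (j.factorial * (poch (1 + a - b) j * poch (1 + a - c) j))) -
      b * c * (j * (poch (-(k : ℂ)) j * poch (a + k) j * poch (a - b - c) j /
          (j.factorial * (poch (1 + a - b) j * poch (1 + a - c) j)))) := by
    intro j
    linear_combination (-P * poch (-(k : ℂ)) j * poch (a + k) j /
      (j.factorial * (poch (1 + a - b) j * poch (1 + a - c) j))) * mul_poch_add_one (a - b - c) j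
  have key : b * c * ∑ j ∈ range (k + 1),
      (j * (poch (-(k : ℂ)) j * poch (a + k) j * poch (a - b - c) j /
          (j.factorial * (poch (1 + a - b) j * poch (1 + a - c) j)))) =
      -((a - b - c) * (k * (a + k)) * (poch b k * poch c k) /
        (poch (1 + a - b) k * poch (1 + a - c) k)) := by
    rcases k with _ | k
    · simp
    have he0 := he 1 (by omega)
    have hf0 := hf 1 (by omega)
    simp only [poch_succ, poch_zero, Nat.cast_zero, add_zero, one_mul] at he0 hf0
    have shift : ∀ x : ℂ, (∀ j ≤ k + 1, poch x j ≠ 0) → ∀ j ≤ k, poch (x + 1) j ≠ 0 := by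
      intro x h j hj h0
      exact h (j + 1) (by omega) (by rw [poch_succ', h0, mul_zero])
    have he' := shift _ he
    have hf' := shift _ hf
    have h := saalschuetz (a + 2) (1 + a - b + 1) (1 + a - c + 1) k he' hf'
    rw [show 1 + a - b + 1 + (1 + a - c + 1) - 1 - (a + 2) = a - b - c + 1 by ring,
      show 1 + (a + 2) - (1 + a - b + 1) = b + 1 by ring,
      show 1 + (a + 2) - (1 + a - c + 1) = c + 1 by ring] at h
    rw [sum_range_succ', Nat.cast_zero, zero_mul, add_zero]
    have step : ∀ j ∈ range (k + 1), (((j + 1 : ℕ) : ℂ) * (poch (-((k + 1 : ℕ) : ℂ)) (j + 1) *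
          poch (a + (k + 1 : ℕ)) (j + 1) * poch (a - b - c) (j + 1) /
          ((j + 1).factorial * (poch (1 + a - b) (j + 1) * poch (1 + a - c) (j + 1))))) =
        -((a - b - c) * ((k + 1) * (a + (k + 1))) / ((1 + a - b) * (1 + a - c))) *
        (poch (-(k : ℂ)) j * poch (a + 2 + k) j * poch (a - b - c + 1) j /
          (j.factorial * (poch (1 + a - b + 1) j * poch (1 + a - c + 1) j))) := by
      intro j hj
      have hj : j ≤ k := Nat.lt_succ_iff.mp (mem_range.mp hj)
      have e2 := he' j hj
      have f2 := hf' j hj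
      have hM : ((j : ℂ) + 1) ≠ 0 := by exact_mod_cast Nat.succ_ne_zero j
      have hF : (j.factorial : ℂ) ≠ 0 := by exact_mod_cast j.factorial_ne_zero
      simp only [poch_succ' _ j, Nat.factorial_succ]
      rw [show -((k + 1 : ℕ) : ℂ) + 1 = -(k : ℂ) by push_cast; ring,
        show a + ((k + 1 : ℕ) : ℂ) + 1 = a + 2 + k by push_cast; ring]
      push_cast
      field_simp
    rw [sum_congr rfl step, ← mul_sum, h]
    have e2 := he' k le_rfl
    have f2 := hf' k le_rfl
    simp only [poch_succ' _ k]
    push_cast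
    field_simp
  simp only [split]
  rw [sum_sub_distrib, ← mul_sum, ← mul_sum, h, key]
  ring

theorem poch_sub_mul_poch (x : ℂ) {j n : ℕ} (hj : j ≤ n) :
    x * (poch (x - j) (n - j) * poch (1 - x - n) (2 * j)) =
      (-1) ^ j * (x - j) * (poch (-x) j * poch x n) := by
  have h1 : poch (1 - x - n) (2 * j) = poch (x + n - (2 * j : ℕ)) (2 * j) := by
    have := poch_reflect (x + n - (2 * j : ℕ)) (2 * j)
    rw [(even_two_mul j).neg_one_pow, one_mul] at this
    rw [← this]; congr 1; ring
  have h2 : poch (x - j) (n - j) * poch (x + n - (2 * j : ℕ)) (2 * j) = poch (x - j) j * poch x n := by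
    have e1 := poch_add (x - j) (n - j) (2 * j)
    have e2 := poch_add (x - j) j n
    rw [show x - j + ((n - j : ℕ) : ℂ) = x + n - (2 * j : ℕ) by
      push_cast [Nat.cast_sub hj]; ring] at e1
    rw [sub_add_cancel] at e2
    rw [← e1, ← e2]; congr 1; omega
  have h3 : poch (x - j) j = (-1) ^ j * poch (1 - x) j := by
    rw [← poch_reflect]; congr 1; ring
  have h4 := mul_poch_add_one (-x) j
  rw [show -x + 1 = 1 - x by ring] at h4
  rw [h1, h2, h3]
  linear_combination (-(-1) ^ j * poch x n) * h4

theorem sum_range_triangle (n : ℕ) (F : ℕ → ℕ → ℂ) :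
    ∑ k ∈ range (n + 1), ∑ j ∈ range (k + 1), F k j =
      ∑ j ∈ range (n + 1), ∑ m ∈ range (n - j + 1), F (j + m) j := by
  rw [Finset.sum_comm' (t' := range (n + 1)) (s' := fun j => Ico j (n + 1))]
  · refine sum_congr rfl fun j hj => ?_
    have hj : j ≤ n := Nat.lt_succ_iff.mp (mem_range.mp hj)
    rw [sum_Ico_eq_sum_range, Nat.succ_sub hj]
  · intro k j; simp only [mem_range, mem_Ico]; omega

theorem poch_product_reindex (n j m : ℕ) (hjm : j + m ≤ n) (a q w : ℂ)
    (hw : ∀ k ≤ n, poch w k ≠ 0) :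
    poch a (j + m) * poch (-(n : ℂ)) (j + m) * (q + (j + m : ℕ)) /
        ((j + m).factorial * poch w (j + m)) *
        (poch (-((j + m : ℕ) : ℂ)) j * poch (a + (j + m : ℕ)) j) =
      (-1) ^ j * poch (-(n : ℂ)) j * poch a (2 * j) / poch w n *
        (((n - j).choose m : ℂ) * ((-1) ^ m * poch (a + 2 * j) m *
          poch (w + j + m) (n - j - m) * (q + j + m))) := by
  have hF : ((j + m).factorial : ℂ) ≠ 0 := by exact_mod_cast (j + m).factorial_ne_zero
  have hW := hw (j + m) hjm
  have hWn := hw n le_rfl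
  have h1 : poch a (j + m) * poch (a + (j + m : ℕ)) j = poch a (2 * j) * poch (a + 2 * j) m := by
    have e := poch_add a (2 * j) m
    push_cast at e
    rw [← poch_add, ← e]; congr 1; ring
  have h2 : poch w n = poch w (j + m) * poch (w + j + m) (n - j - m) := by
    have e := poch_add w (j + m) (n - j - m)
    rw [show j + m + (n - j - m) = n by omega] at e
    rw [e]; push_cast; rw [add_assoc]
  have h3 : poch (-(n : ℂ)) (j + m) =
      poch (-(n : ℂ)) j * ((-1) ^ m * ((n - j).choose m : ℂ) * m.factorial) := by
    rw [poch_add, ← poch_neg_natCast, Nat.cast_sub (by omega)]; congr 2; ring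
  have h4 := poch_neg_add_mul_factorial j m
  have hT : poch (w + j + m) (n - j - m) ≠ 0 := right_ne_zero_of_mul (h2 ▸ hWn)
  calc _ = (poch a (j + m) * poch (a + (j + m : ℕ)) j) * poch (-(n : ℂ)) j * (-1) ^ m *
        ((n - j).choose m : ℂ) * (q + (j + m : ℕ)) *
        (poch (-((j + m : ℕ) : ℂ)) j * (m.factorial : ℂ)) /
          ((j + m).factorial * poch w (j + m)) := by rw [h3]; ring
    _ = _ := by
      rw [h1, h4, h2]
      push_cast
      field_simp
      ring

theorem poch_div_poch {z : ℂ} {k : ℕ} (hz : z ≠ 0) (hk : poch z k ≠ 0) :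
    poch (z + 1) k / poch z k = (z + k) / z := by
  rw [div_eq_div_iff hk hz, mul_comm _ z, mul_poch_add_one, mul_comm]

theorem add_ne_zero_of_poch_ne_zero {z : ℂ} {k i : ℕ} (hk : poch z k ≠ 0) (hi : i < k) :
    z + i ≠ 0 := by
  obtain ⟨d, rfl⟩ := Nat.exists_eq_add_of_lt hi
  rw [show i + d + 1 = i + (d + 1) by ring, poch_add, poch_succ'] at hk
  exact left_ne_zero_of_mul (right_ne_zero_of_mul hk)

/-- The linear factors produced by the Chu–Vandermonde sum collapse to a single one. -/
theorem inner_sum_eval {n j : ℕ} (hj : j ≤ n) (a q w : ℂ) (hx : w - a - 1 ≠ 0)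
    (hxj : w - a - 1 - j ≠ 0) (hH : poch (2 + a - w - n) (2 * j) ≠ 0) :
    ∑ m ∈ range (n - j + 1), (((n - j).choose m : ℂ) * ((-1) ^ m * poch (a + 2 * j) m *
        poch (w + j + m) (n - j - m) * (q + j + m))) =
      -(q * (1 + a - w) + n * (a - q) + j * (1 + 2 * q - w + n)) * (-1) ^ j *
        (poch (1 + a - w) j * poch (w - a - 1) n) /
        ((w - a - 1) * poch (2 + a - w - n) (2 * j)) := by
  have h1 := chu_vandermonde_weighted (n - j) (a + 2 * j) (q + j) (w + j)
  have h2 := poch_sub_mul_poch (w - a - 1) hj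
  rw [show w + (j : ℂ) - (a + 2 * j) - 1 = w - a - 1 - j by ring, Nat.cast_sub hj] at h1
  rw [show 1 - (w - a - 1) - (n : ℂ) = 2 + a - w - n by ring,
    show -(w - a - 1) = 1 + a - w by ring] at h2
  rw [eq_div_iff (mul_ne_zero hx hH)]
  apply mul_left_cancel₀ hxj
  linear_combination ((w - a - 1) * poch (2 + a - w - n) (2 * j)) * h1 -
    (q * (1 + a - w) + n * (a - q) + j * (1 + 2 * q - w + n)) * h2

end PochhammerSums

theorem proposition_3_2 (n : ℕ) (a b c p q w : ℂ)
    (haq : a - q ≠ 0) (hqw : 1 + 2 * q - w + (n : ℂ) ≠ 0)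
    (hbc : b * c - p * (a - p) ≠ 0)
    (α β γ : ℂ)
    (hα : α = q * (1 + a - w) / (a - q))
    (hβ : β = (q * (1 + a - w) + (n : ℂ) * (a - q)) / (1 + 2 * q - w + (n : ℂ)))
    (hγ : γ = p * (a - p) * (b + c - a) / (b * c - p * (a - p)))
    (hnd : ∀ z ∈ [1 + a - b, 1 + a - c, p, a - p, q, w,
        (2 + a - w - (n : ℂ)) / 2, (3 + a - w - (n : ℂ)) / 2, β, γ, α],
      ∀ k ≤ n, poch z k ≠ 0) :
    hypTerm [a, b, c, a - p + 1, p + 1, q + 1] [1 + a - b, 1 + a - c, p, a - p, q, w] n 1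
      = poch (w - a - 1) n * poch (α + 1) n / (poch w n * poch α n) *
        hypTerm [1 + a - w, a / 2, (a + 1) / 2, a - b - c, β + 1, γ + 1]
          [1 + a - b, 1 + a - c, (2 + a - w - (n : ℂ)) / 2, (3 + a - w - (n : ℂ)) / 2, β, γ]
          n 1 := by
  rcases Nat.eq_zero_or_pos n with rfl | hn
  · simp [hypTerm, poch_zero]
  simp only [List.forall_mem_cons, List.not_mem_nil, false_imp_iff, implies_true, and_true] at hnd
  obtain ⟨he, hf, hp, hap, hq, hw, hh1, hh2, hβk, hγk, hαk⟩ := hnd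
  have ne_of : ∀ {z : ℂ}, (∀ k ≤ n, poch z k ≠ 0) → z ≠ 0 := fun h => by
    simpa [poch_succ, poch_zero] using h 1 hn
  have hp0 := ne_of hp
  have hap0 := ne_of hap
  have hq0 := ne_of hq
  have hα0 := ne_of hαk
  have hβ0 := ne_of hβk
  have hγ0 := ne_of hγk
  have hx' : 1 + a - w ≠ 0 := by
    intro h; exact hα0 (by rw [hα, h]; simp)
  have hx : w - a - 1 ≠ 0 := by
    intro h; exact hx' (by linear_combination -h)
  have hs : a - b - c ≠ 0 := by
    intro h; exact hγ0 (by rw [hγ, show b + c - a = -(a - b - c) by ring, h]; simp)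
  have hN : q * (1 + a - w) + (n : ℂ) * (a - q) ≠ 0 := by
    intro h; exact hβ0 (by rw [hβ, h]; simp)
  have hHeq : ∀ j, 4 ^ j * (poch ((2 + a - w - n) / 2) j * poch ((3 + a - w - n) / 2) j) =
      poch (2 + a - w - n) (2 * j) := fun j => by
    rw [← poch_half_mul]; congr 4; ring
  have hH : ∀ j ≤ n, poch (2 + a - w - n) (2 * j) ≠ 0 := fun j hj => by
    rw [← hHeq]
    exact mul_ne_zero (pow_ne_zero _ (by norm_num)) (mul_ne_zero (hh1 j hj) (hh2 j hj))
  have hxj : ∀ j ≤ n, w - a - 1 - (j : ℂ) ≠ 0 := fun j hj h => by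
    refine add_ne_zero_of_poch_ne_zero (hH n le_rfl) (show n + j - 1 < 2 * n by omega) ?_
    rw [Nat.cast_sub (by omega)]; push_cast
    linear_combination -h
  set T : ℕ → ℂ := fun j => poch (a - b - c) j * ((γ + j) / γ) /
    (j.factorial * (poch (1 + a - b) j * poch (1 + a - c) j)) with hT
  have hγj : ∀ j : ℕ, (γ + j) / γ =
      (p * (a - p) * (a - b - c + j) - j * (b * c)) / ((a - b - c) * (p * (a - p))) := by
    intro j
    rw [div_eq_div_iff hγ0 (by positivity), hγ]
    field_simp
    ring
  have hL : ∀ k ∈ Finset.range (n + 1),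
      (([a, b, c, a - p + 1, p + 1, q + 1].map fun a => poch a k).prod * poch (-(n : ℂ)) k) /
        ((k.factorial : ℂ) *
          ([1 + a - b, 1 + a - c, p, a - p, q, w].map fun b => poch b k).prod) * 1 ^ k =
      ∑ j ∈ Finset.range (k + 1), poch a k * poch (-(n : ℂ)) k * (q + k) /
        (k.factorial * poch w k) * (poch (-(k : ℂ)) j * poch (a + k) j) * (T j / q) := by
    intro k hk
    have hk : k ≤ n := Nat.lt_succ_iff.mp (Finset.mem_range.mp hk)
    have h := saalschuetz_weighted a b c (p * (a - p)) k hs (fun j hj => he j (hj.trans hk))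
      (fun j hj => hf j (hj.trans hk))
    have hsum : ∑ j ∈ Finset.range (k + 1), poch (-(k : ℂ)) j * poch (a + k) j * T j =
        (p + k) / p * ((a - p + k) / (a - p)) * (poch b k * poch c k) /
          (poch (1 + a - b) k * poch (1 + a - c) k) := by
      have hP : (a - b - c) * (p * (a - p)) ≠ 0 := by positivity
      apply mul_left_cancel₀ hP
      rw [Finset.mul_sum]
      refine Eq.trans (Finset.sum_congr rfl fun j _ => ?_) (h.trans ?_)
      · simp only [hT, hγj]; field_simp
      · have := he k hk
        have := hf k hk
        field_simp
        ring
    calc _ = poch a k * poch (-(n : ℂ)) k / (k.factorial * poch w k) *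
          (poch (q + 1) k / poch q k) * ((poch (p + 1) k / poch p k) *
            (poch (a - p + 1) k / poch (a - p) k) * (poch b k * poch c k) /
              (poch (1 + a - b) k * poch (1 + a - c) k)) := by
          simp only [List.map_cons, List.map_nil, List.prod_cons, List.prod_nil, one_pow]
          ring
      _ = poch a k * poch (-(n : ℂ)) k * (q + k) / (k.factorial * poch w k) / q *
          ∑ j ∈ Finset.range (k + 1), poch (-(k : ℂ)) j * poch (a + k) j * T j := by
          rw [poch_div_poch hq0 (hq k hk), poch_div_poch hp0 (hp k hk),
            poch_div_poch hap0 (hap k hk), hsum]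
          ring
      _ = _ := by
          rw [Finset.mul_sum]
          exact Finset.sum_congr rfl fun j _ => by ring
  unfold hypTerm
  rw [Finset.sum_congr rfl hL, sum_range_triangle, Finset.mul_sum]
  refine Finset.sum_congr rfl fun j hj => ?_
  have hj : j ≤ n := Nat.lt_succ_iff.mp (Finset.mem_range.mp hj)
  have hinner : ∀ m ∈ Finset.range (n - j + 1),
      poch a (j + m) * poch (-(n : ℂ)) (j + m) * (q + (j + m : ℕ)) /
        ((j + m).factorial * poch w (j + m)) *
        (poch (-((j + m : ℕ) : ℂ)) j * poch (a + (j + m : ℕ)) j) * (T j / q) =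
      (-1) ^ j * poch (-(n : ℂ)) j * poch a (2 * j) / poch w n * (T j / q) *
        (((n - j).choose m : ℂ) * ((-1) ^ m * poch (a + 2 * j) m *
          poch (w + j + m) (n - j - m) * (q + j + m))) := by
    intro m hm
    rw [poch_product_reindex n j m (by rw [Finset.mem_range] at hm; omega) a q w hw]
    ring
  rw [Finset.sum_congr rfl hinner, ← Finset.mul_sum,
    inner_sum_eval hj a q w hx (hxj j hj) (hH j hj)]
  have hαn : (α + n) / α = -(q * (1 + a - w) + n * (a - q)) / (q * (w - a - 1)) := by
    rw [div_eq_div_iff hα0 (mul_ne_zero hq0 hx), hα]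
    field_simp
    ring
  have hβj : (β + j) / β = (q * (1 + a - w) + n * (a - q) + j * (1 + 2 * q - w + n)) /
      (q * (1 + a - w) + n * (a - q)) := by
    have hβD := (eq_div_iff hqw).mp hβ
    rw [div_eq_div_iff hβ0 hN]
    linear_combination -(j : ℂ) * hβD
  have hhalf : poch (a / 2) j * poch ((a + 1) / 2) j /
      (poch ((2 + a - w - n) / 2) j * poch ((3 + a - w - n) / 2) j) =
      poch a (2 * j) / poch (2 + a - w - n) (2 * j) := by
    rw [← hHeq, ← poch_half_mul, mul_div_mul_left _ _ (pow_ne_zero _ (by norm_num))]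
  symm
  calc _ = poch (w - a - 1) n / poch w n * (poch (α + 1) n / poch α n) *
        (poch (1 + a - w) j * (poch (a / 2) j * poch ((a + 1) / 2) j /
          (poch ((2 + a - w - n) / 2) j * poch ((3 + a - w - n) / 2) j)) *
          poch (a - b - c) j * (poch (β + 1) j / poch β j) * (poch (γ + 1) j / poch γ j) *
          poch (-(n : ℂ)) j / (j.factorial * (poch (1 + a - b) j * poch (1 + a - c) j))) := by
        simp only [List.map_cons, List.map_nil, List.prod_cons, List.prod_nil, one_pow]
        ring
    _ = _ := by
        have hsign : ((-1 : ℂ) ^ j) ^ 2 = 1 := by rw [← pow_mul, mul_comm, pow_mul]; simp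
        have := he j hj
        have := hf j hj
        have := hH j hj
        have := hw n le_rfl
        have hF : (j.factorial : ℂ) ≠ 0 := by exact_mod_cast j.factorial_ne_zero
        rw [poch_div_poch hα0 (hαk n le_rfl), poch_div_poch hβ0 (hβk j hj),
          poch_div_poch hγ0 (hγk j hj), hhalf, hαn, hβj]
        simp only [hT]
        field_simp
        rw [hsign, mul_one]
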